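/- arXiv:2105.12579 — 2 statements merged into one kernel-verified Lean document; each statement's English description precedes it below -/
import Mathlib

section
/- Let H be an N×N Hermitian complex matrix, S a subset of its index set with complement S̄, and T a normal, invertible |S|×|S| complex matrix. Then the following are equivalent: (i) T commutes with the isospectral reduction R_S(H,λ) = H_{SS} + H_{SS̄}(λI − H_{S̄S̄})⁻¹ H_{S̄S} for every complex number λ that is not an eigenvalue of H_{S̄S̄}; (ii) T commutes with ((H^k))_{SS} for every natural number k; (iii) there exists a normal N×N complex matrix Q with Q_{SS} = T, Q_{SS̄} = 0, Q_{S̄S} = 0, and QH = HQ. -/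
open Matrix

namespace IsoRed

lemma aux {E V : Type*} [NormedAddCommGroup E] [InnerProductSpace ℂ E] [FiniteDimensional ℂ E]
    [AddCommGroup V] [Module ℂ V] (φ : V →ₗ[ℂ] E) (τ τ' σ : V →ₗ[ℂ] V) (A : E →ₗ[ℂ] E)
    (h : ∀ u v, inner ℂ (φ (τ v)) (φ u) = inner ℂ (φ v) (φ (τ' u)))
    (hc : ∀ v, τ (τ' v) = τ' (τ v)) (hs : ∀ v, τ (σ v) = σ (τ v))
    (hA : ∀ x y, inner ℂ (A x) y = inner ℂ x (A y)) (hAs : ∀ v, A (φ v) = φ (σ v)) :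
    ∃ q : E →ₗ[ℂ] E, (∀ v, q (φ v) = φ (τ v)) ∧ (∀ v, q.adjoint (φ v) = φ (τ' v)) ∧
      q * q.adjoint = q.adjoint * q ∧ q * A = A * q := by
  obtain ⟨g, hg⟩ := φ.rangeRestrict.exists_rightInverse_of_surjective φ.range_rangeRestrict
  have hg' : ∀ w : LinearMap.range φ, φ (g w) = w := fun w => by
    have := LinearMap.congr_fun hg w
    exact congrArg Subtype.val this
  -- well-definedness
  have wd : ∀ v, φ v = 0 → φ (τ v) = 0 := fun v hv => by
    have h1 : ∀ u, inner ℂ (φ (τ v)) (φ u) = 0 := fun u => by rw [h, hv, inner_zero_left]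
    exact inner_self_eq_zero.1 (h1 (τ v))
  let W := LinearMap.range φ
  let q : E →ₗ[ℂ] E := φ ∘ₗ τ ∘ₗ g ∘ₗ (W.orthogonalProjectionOnto : E →ₗ[ℂ] W)
  have q1 : ∀ v, q (φ v) = φ (τ v) := fun v => by
    have : W.orthogonalProjectionOnto (φ v) = ⟨φ v, v, rfl⟩ :=
      Submodule.orthogonalProjectionOnto_mem_subspace_eq_self (K := W) ⟨φ v, v, rfl⟩
    have e : q (φ v) = φ (τ (g ⟨φ v, v, rfl⟩)) := by simp only [q]; simp [this]
    rw [e, ← sub_eq_zero, ← map_sub, ← map_sub]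
    apply wd
    rw [map_sub, hg']; simp
  have q0 : ∀ w ∈ Wᗮ, q w = 0 := fun w hw => by
    simp [q, Submodule.orthogonalProjectionOnto_apply_of_mem_orthogonal hw]
  have qW : ∀ x, q x ∈ W := fun x => ⟨_, rfl⟩
  have ext : ∀ x : E, ∃ v, ∃ w ∈ Wᗮ, x = φ v + w := fun x => by
    obtain ⟨y, ⟨v, rfl⟩, z, hz, e⟩ := W.exists_add_mem_mem_orthogonal x
    exact ⟨v, z, hz, e⟩
  have in0 : ∀ v, ∀ w ∈ Wᗮ, inner ℂ (φ v) w = 0 := fun v w hw =>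
    (Submodule.mem_orthogonal _ _).1 hw _ ⟨v, rfl⟩
  have in0' : ∀ v, ∀ w ∈ Wᗮ, inner ℂ w (φ v) = 0 := fun v w hw =>
    (Submodule.mem_orthogonal' _ _).1 hw _ ⟨v, rfl⟩
  have q2 : ∀ v, q.adjoint (φ v) = φ (τ' v) := fun v => by
    apply ext_inner_left ℂ
    intro x
    obtain ⟨u, w, hw, rfl⟩ := ext x
    rw [LinearMap.adjoint_inner_right, map_add, q1, q0 w hw, add_zero, h, inner_add_left,
      in0' _ w hw, add_zero]
  have q3 : ∀ w ∈ Wᗮ, q.adjoint w = 0 := fun w hw => by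
    apply ext_inner_left ℂ
    intro x
    rw [LinearMap.adjoint_inner_right, inner_zero_right]
    exact (Submodule.mem_orthogonal _ _).1 hw _ (qW x)
  have hAW : ∀ w ∈ Wᗮ, A w ∈ Wᗮ := fun w hw => by
    rw [Submodule.mem_orthogonal]
    rintro _ ⟨v, rfl⟩
    rw [← hA, hAs]; exact in0 _ w hw
  refine ⟨q, q1, q2, ?_, ?_⟩
  · ext x
    obtain ⟨u, w, hw, rfl⟩ := ext x
    simp [q1, q2, q0 w hw, q3 w hw, hc]
  · ext x
    obtain ⟨u, w, hw, rfl⟩ := ext x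
    simp [q1, hAs, q0 w hw, q0 _ (hAW w hw), hs]

lemma tmul {a b c : Type*} [Fintype b] [Fintype c]
    [DecidableEq b] [DecidableEq c] (M : Matrix a b ℂ) (M' : Matrix b c ℂ)
    (x : EuclideanSpace ℂ c) :
    toEuclideanLin M (toEuclideanLin M' x) = toEuclideanLin (M * M') x := by
  simp [toEuclideanLin, Matrix.toLpLin_apply]

lemma two_three {n s : Type*} [Fintype n] [DecidableEq n] [Fintype s] [DecidableEq s]
    (H : Matrix n n ℂ) (hH : H.IsHermitian) (J : Matrix n s ℂ)
    (T : Matrix s s ℂ) (hT : T * Tᴴ = Tᴴ * T)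
    (h : ∀ k : ℕ, T * (Jᴴ * H ^ k * J) = (Jᴴ * H ^ k * J) * T) :
    ∃ Q : Matrix n n ℂ, Q * Qᴴ = Qᴴ * Q ∧ Q * J = J * T ∧ Qᴴ * J = J * Tᴴ ∧ Q * H = H * Q := by
  have key : ∀ k, Tᴴ * (Jᴴ * H ^ k * J) = (Jᴴ * H ^ k * J) * Tᴴ := fun k => by
    have := congrArg conjTranspose (h k)
    simp only [conjTranspose_mul, conjTranspose_pow, hH.eq, conjTranspose_conjTranspose] at this
    simp only [Matrix.mul_assoc] at this ⊢
    exact this.symm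
  let φ : (ℕ →₀ EuclideanSpace ℂ s) →ₗ[ℂ] EuclideanSpace ℂ n :=
    Finsupp.lsum ℂ (fun k => toEuclideanLin (H ^ k * J))
  have φs : ∀ k x, φ (Finsupp.single k x) = toEuclideanLin (H ^ k * J) x := by
    intros; simp [φ]
  let m : Matrix s s ℂ → (ℕ →₀ EuclideanSpace ℂ s) →ₗ[ℂ] (ℕ →₀ EuclideanSpace ℂ s) :=
    fun M => Finsupp.mapRange.linearMap (toEuclideanLin M)
  have ms : ∀ M k x, m M (Finsupp.single k x) = Finsupp.single k (toEuclideanLin M x) := by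
    intros; simp [m]
  let σ : (ℕ →₀ EuclideanSpace ℂ s) →ₗ[ℂ] (ℕ →₀ EuclideanSpace ℂ s) :=
    Finsupp.lmapDomain _ ℂ Nat.succ
  have σs : ∀ k x, σ (Finsupp.single k x) = Finsupp.single (k+1) x := by
    intros; simp [σ]
  obtain ⟨q, q1, q2, q3, q4⟩ := aux φ (m T) (m Tᴴ) σ (toEuclideanLin H) (by
    intro u v
    induction u using Finsupp.induction_linear with
    | zero => simp
    | add a b ha hb => simp only [map_add, inner_add_right, ha, hb]
    | single j y =>
      induction v using Finsupp.induction_linear with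
      | zero => simp
      | add a b ha hb => simp only [map_add, inner_add_left, ha, hb]
      | single k x =>
        rw [ms, ms, φs, φs, φs, φs, tmul, tmul, ← LinearMap.adjoint_inner_right,
          ← LinearMap.adjoint_inner_right, ← toEuclideanLin_conjTranspose_eq_adjoint,
          ← toEuclideanLin_conjTranspose_eq_adjoint, tmul, tmul]
        congr 3
        have := key (k + j)
        simp only [conjTranspose_mul, conjTranspose_pow, hH.eq]
        simp only [pow_add, Matrix.mul_assoc] at this ⊢
        exact this)
    (by
      intro v
      induction v using Finsupp.induction_linear with
      | zero => simp
      | add a b ha hb => simp only [map_add, ha, hb]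
      | single k x => simp only [ms, tmul, hT])
    (by
      intro v
      induction v using Finsupp.induction_linear with
      | zero => simp
      | add a b ha hb => simp only [map_add, ha, hb]
      | single k x => simp only [ms, σs])
    (by
      intro x y
      rw [← LinearMap.adjoint_inner_right, ← toEuclideanLin_conjTranspose_eq_adjoint, hH.eq])
    (by
      intro v
      induction v using Finsupp.induction_linear with
      | zero => simp
      | add a b ha hb => simp only [map_add, ha, hb]
      | single k x => simp only [φs, σs, tmul, pow_succ', Matrix.mul_assoc])
  obtain ⟨Q, rfl⟩ := (toEuclideanLin (𝕜 := ℂ) (m := n) (n := n)).surjective q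
  rw [← toEuclideanLin_conjTranspose_eq_adjoint] at q2 q3
  refine ⟨Q, ?_, ?_, ?_, ?_⟩
  · apply toEuclideanLin.injective
    ext1 x
    rw [← tmul, ← tmul]
    exact LinearMap.congr_fun q3 x
  · apply toEuclideanLin.injective
    ext1 x
    have := q1 (Finsupp.single 0 x)
    rw [ms, φs, φs, tmul, tmul, pow_zero, Matrix.one_mul] at this
    exact this
  · apply toEuclideanLin.injective
    ext1 x
    have := q2 (Finsupp.single 0 x)
    rw [ms, φs, φs, tmul, tmul, pow_zero, Matrix.one_mul] at this
    exact this
  · apply toEuclideanLin.injective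
    ext1 x
    rw [← tmul, ← tmul]
    exact LinearMap.congr_fun q4 x

open Filter Topology in
lemma lim {n : Type*} [Fintype n] [DecidableEq n] (H : Matrix n n ℂ) :
    Tendsto (fun z : ℂ => z • (z • (1 : Matrix n n ℂ) - H)⁻¹) (Bornology.cobounded ℂ) (𝓝 1) := by
  have c : Tendsto (fun w : ℂ => (1 - w • H)⁻¹) (𝓝 0) (𝓝 1) := by
    have h1 : Continuous (fun w : ℂ => 1 - w • H) := by fun_prop
    have h2 : Tendsto (fun w : ℂ => (1 - w • H).det⁻¹ • (1 - w • H).adjugate) (𝓝 0)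
        (𝓝 ((1 - (0:ℂ) • H).det⁻¹ • (1 - (0:ℂ) • H).adjugate)) :=
      ((h1.matrix_det.tendsto 0).inv₀ (by simp)).smul (h1.matrix_adjugate.tendsto 0)
    simpa [Matrix.inv_def] using h2
  refine (c.comp tendsto_inv₀_cobounded).congr' ?_
  filter_upwards [Bornology.eventually_ne_cobounded (0:ℂ)] with z hz
  have : (1 - z⁻¹ • H) = z⁻¹ • (z • (1 : Matrix n n ℂ) - H) := by
    rw [smul_sub, smul_smul, inv_mul_cancel₀ hz, one_smul]
  have hu : (Units.mk0 z hz)⁻¹ • (z • (1 : Matrix n n ℂ) - H) = 1 - z⁻¹ • H := by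
    rw [this]; rfl
  simp only [Function.comp]
  rw [this]
  by_cases hd : IsUnit (z • (1 : Matrix n n ℂ) - H).det
  · apply Matrix.inv_eq_right_inv
    rw [smul_mul_smul_comm, inv_mul_cancel₀ hz, one_smul, Matrix.mul_nonsing_inv _ hd]
  · rw [Matrix.nonsing_inv_apply_not_isUnit _ hd, Matrix.nonsing_inv_apply_not_isUnit, smul_zero]
    rwa [det_smul, IsUnit.mul_iff, and_iff_right]
    exact ((isUnit_iff_ne_zero.2 (inv_ne_zero hz)).pow _)

open Filter Topology in
lemma good {n : Type*} [Fintype n] [DecidableEq n] (H : Matrix n n ℂ) :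
    ∀ᶠ z in Bornology.cobounded ℂ, z ∉ spectrum ℂ H := by
  have := (Matrix.finite_spectrum H).isBounded
  exact Bornology.isBounded_def.1 this

lemma good' {n : Type*} [Fintype n] [DecidableEq n] {H : Matrix n n ℂ} {z : ℂ}
    (hz : z ∉ spectrum ℂ H) : IsUnit (z • (1 : Matrix n n ℂ) - H).det := by
  rw [spectrum.notMem_iff, Algebra.algebraMap_eq_smul_one] at hz
  exact (Matrix.isUnit_iff_isUnit_det _).1 hz

open Filter Topology in
lemma one_two {n s s' : Type*} [Fintype n] [DecidableEq n] [Fintype s] [DecidableEq s]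
    [Fintype s'] [DecidableEq s']
    (H : Matrix n n ℂ) (J : Matrix n s ℂ) (J' : Matrix n s' ℂ) (T : Matrix s s ℂ)
    (hJ : Jᴴ * J = 1) (hJ'J : J'ᴴ * J = 0) (hJJ : J * Jᴴ + J' * J'ᴴ = 1)
    (h : ∀ z : ℂ, z ∉ spectrum ℂ (J'ᴴ * H * J') →
      Commute T (Jᴴ * H * J + (Jᴴ * H * J') * (z • 1 - J'ᴴ * H * J')⁻¹ * (J'ᴴ * H * J)))
    (k : ℕ) : Commute T (Jᴴ * H ^ k * J) := by
  have L : ∀ k : ℕ, (∀ᶠ z in Bornology.cobounded ℂ,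
      Commute T (Jᴴ * ((z • (z • 1 - H)⁻¹) * H ^ k) * J)) → Commute T (Jᴴ * H ^ k * J) := by
    intro k hk
    have l1 : Tendsto (fun z : ℂ => Jᴴ * ((z • (z • 1 - H)⁻¹) * H ^ k) * J)
        (Bornology.cobounded ℂ) (𝓝 (Jᴴ * H ^ k * J)) := by
      have c : Continuous (fun X : Matrix n n ℂ => Jᴴ * (X * H ^ k) * J) := by fun_prop
      have := (c.tendsto 1).comp (lim H)
      rw [Matrix.one_mul] at this
      exact this
    have c1 : Continuous (fun X : Matrix s s ℂ => T * X) := by fun_prop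
    have c2 : Continuous (fun X : Matrix s s ℂ => X * T) := by fun_prop
    refine tendsto_nhds_unique_of_eventuallyEq ((c1.tendsto _).comp l1) ((c2.tendsto _).comp l1) ?_
    filter_upwards [hk] with z hz using hz
  have P : ∀ k : ℕ, ∀ᶠ z in Bornology.cobounded ℂ,
      Commute T (Jᴴ * ((z • (z • 1 - H)⁻¹) * H ^ k) * J) := by
    intro k
    induction k with
    | zero =>
      filter_upwards [good H, good (J'ᴴ * H * J')] with z hz hz'
      have hR := h z hz'
      have u1 := Matrix.mul_nonsing_inv _ (good' hz)
      have u2 := Matrix.nonsing_inv_mul _ (good' hz')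
      set X := (z • (1 : Matrix n n ℂ) - H)⁻¹
      set Y := (z • 1 - J'ᴴ * H * J')⁻¹
      set R := Jᴴ * H * J + (Jᴴ * H * J') * Y * (J'ᴴ * H * J) with hRdef
      have hX : z • X = 1 + H * X := by
        rw [Matrix.sub_mul, Matrix.smul_mul, Matrix.one_mul] at u1
        rw [← u1]; abel
      have dec : ∀ {t : Type _} (M : Matrix n t ℂ), M = J * (Jᴴ * M) + J' * (J'ᴴ * M) := by
        intro t M
        rw [← Matrix.mul_assoc, ← Matrix.mul_assoc, ← Matrix.add_mul, hJJ, Matrix.one_mul]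
      set X1 := Jᴴ * (X * J) with hX1
      set X2 := J'ᴴ * (X * J) with hX2
      have hXJ : X * J = J * X1 + J' * X2 := dec _
      have e0 : z • (X * J) = J + H * (J * X1 + J' * X2) := by
        rw [← hXJ, ← Matrix.smul_mul, hX, Matrix.add_mul, Matrix.one_mul, Matrix.mul_assoc]
      have e1 : z • X1 = 1 + (Jᴴ * H * J) * X1 + (Jᴴ * H * J') * X2 := by
        rw [hX1, ← Matrix.mul_smul, e0, Matrix.mul_add, Matrix.mul_add, Matrix.mul_add, hJ]
        simp only [Matrix.mul_assoc, add_assoc]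
        rfl
      have e2 : z • X2 = (J'ᴴ * H * J) * X1 + (J'ᴴ * H * J') * X2 := by
        rw [hX2, ← Matrix.mul_smul, e0, Matrix.mul_add, Matrix.mul_add, Matrix.mul_add, hJ'J,
          zero_add]
        simp only [Matrix.mul_assoc]
        rfl
      have e3 : X2 = Y * ((J'ᴴ * H * J) * X1) := by
        have : (z • 1 - J'ᴴ * H * J') * X2 = (J'ᴴ * H * J) * X1 := by
          rw [Matrix.sub_mul, Matrix.smul_mul, Matrix.one_mul, e2, add_sub_cancel_right]
        rw [← this, ← Matrix.mul_assoc, u2, Matrix.one_mul]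
      have e4 : (z • 1 - R) * X1 = 1 := by
        rw [Matrix.sub_mul, Matrix.smul_mul, Matrix.one_mul, e1, hRdef, Matrix.add_mul]
        nth_rewrite 1 [e3]
        simp only [Matrix.mul_assoc]
        abel
      have e5 : X1 * (z • 1 - R) = 1 := mul_eq_one_comm.1 e4
      have hc : Commute T (z • 1 - R) :=
        ((Commute.one_right T).smul_right z).sub_right hR
      have hc1 : Commute T X1 := by
        let U : (Matrix s s ℂ)ˣ := ⟨z • 1 - R, X1, e4, e5⟩
        have : Commute T (U : Matrix s s ℂ) := hc
        exact this.units_inv_right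
      have : Jᴴ * (z • X * H ^ 0) * J = z • X1 := by
        rw [pow_zero, Matrix.mul_one, Matrix.mul_smul, Matrix.smul_mul, Matrix.mul_assoc]
      rw [this]
      exact hc1.smul_right z
    | succ k ih =>
      have hk := L k ih
      filter_upwards [ih, good H] with z hz hzH
      have u1 := Matrix.nonsing_inv_mul _ (good' hzH)
      set X := (z • (1 : Matrix n n ℂ) - H)⁻¹
      have hX : X * H = z • X - 1 := by
        rw [Matrix.mul_sub, Matrix.mul_smul, Matrix.mul_one] at u1
        rw [← u1]; abel
      have : Jᴴ * (z • X * H ^ (k + 1)) * J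
          = z • (Jᴴ * (z • X * H ^ k) * J - Jᴴ * H ^ k * J) := by
        rw [pow_succ', ← Matrix.mul_assoc (z • X), Matrix.smul_mul z X H, hX,
          ← Matrix.sub_mul, ← Matrix.mul_sub, Matrix.smul_mul, Matrix.mul_smul, Matrix.smul_mul,
          Matrix.sub_mul, Matrix.one_mul]
      rw [this]
      exact (hz.sub_right hk).smul_right z
  exact L k (P k)

lemma three_one {n s s' : Type*} [Fintype n] [DecidableEq n] [Fintype s] [DecidableEq s]
    [Fintype s'] [DecidableEq s']
    (H Q : Matrix n n ℂ) (J : Matrix n s ℂ) (J' : Matrix n s' ℂ) (T : Matrix s s ℂ)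
    (hJJ : J * Jᴴ + J' * J'ᴴ = 1)
    (h1 : Jᴴ * Q * J = T) (h2 : Jᴴ * Q * J' = 0) (h3 : J'ᴴ * Q * J = 0) (hQ : Q * H = H * Q)
    (z : ℂ) (hz : z ∉ spectrum ℂ (J'ᴴ * H * J')) :
      T * (Jᴴ * H * J + (Jᴴ * H * J') * (z • 1 - J'ᴴ * H * J')⁻¹ * (J'ᴴ * H * J)) =
      (Jᴴ * H * J + (Jᴴ * H * J') * (z • 1 - J'ᴴ * H * J')⁻¹ * (J'ᴴ * H * J)) * T := by
  have d1 : Q = Q * (J * Jᴴ + J' * J'ᴴ) := by rw [hJJ, Matrix.mul_one]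
  have d2 : Q = (J * Jᴴ + J' * J'ᴴ) * Q := by rw [hJJ, Matrix.one_mul]
  set K := J'ᴴ * Q * J' with hK
  have a1 : Jᴴ * Q = T * Jᴴ := by
    conv_lhs => rw [d1]
    rw [Matrix.mul_add, Matrix.mul_add, ← Matrix.mul_assoc, ← Matrix.mul_assoc,
      ← Matrix.mul_assoc, ← Matrix.mul_assoc, h1, h2, Matrix.zero_mul, add_zero]
  have a2 : J'ᴴ * Q = K * J'ᴴ := by
    conv_lhs => rw [d1]
    rw [Matrix.mul_add, Matrix.mul_add, ← Matrix.mul_assoc, ← Matrix.mul_assoc,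
      ← Matrix.mul_assoc, ← Matrix.mul_assoc, h3, Matrix.zero_mul, zero_add]
  have a3 : Q * J = J * T := by
    conv_lhs => rw [d2]
    rw [Matrix.add_mul, Matrix.add_mul, Matrix.mul_assoc, Matrix.mul_assoc, Matrix.mul_assoc,
      Matrix.mul_assoc, ← Matrix.mul_assoc Jᴴ, ← Matrix.mul_assoc J'ᴴ, h1, h3, Matrix.mul_zero,
      add_zero]
  have a4 : Q * J' = J' * K := by
    conv_lhs => rw [d2]
    rw [Matrix.add_mul, Matrix.add_mul, Matrix.mul_assoc, Matrix.mul_assoc, Matrix.mul_assoc,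
      Matrix.mul_assoc, ← Matrix.mul_assoc Jᴴ, ← Matrix.mul_assoc J'ᴴ, h2, Matrix.mul_zero,
      zero_add]
  have c1 : T * (Jᴴ * H * J) = (Jᴴ * H * J) * T := by
    rw [← Matrix.mul_assoc, ← Matrix.mul_assoc, ← a1, Matrix.mul_assoc Jᴴ, hQ,
      Matrix.mul_assoc _ J T, ← a3]
    simp only [Matrix.mul_assoc]
  have c2 : T * (Jᴴ * H * J') = (Jᴴ * H * J') * K := by
    rw [← Matrix.mul_assoc, ← Matrix.mul_assoc, ← a1, Matrix.mul_assoc Jᴴ, hQ,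
      Matrix.mul_assoc _ J' K, ← a4]
    simp only [Matrix.mul_assoc]
  have c3 : K * (J'ᴴ * H * J) = (J'ᴴ * H * J) * T := by
    rw [← Matrix.mul_assoc, ← Matrix.mul_assoc, ← a2, Matrix.mul_assoc J'ᴴ, hQ,
      Matrix.mul_assoc _ J T, ← a3]
    simp only [Matrix.mul_assoc]
  have c4 : K * (J'ᴴ * H * J') = (J'ᴴ * H * J') * K := by
    rw [← Matrix.mul_assoc, ← Matrix.mul_assoc, ← a2, Matrix.mul_assoc J'ᴴ, hQ,
      Matrix.mul_assoc _ J' K, ← a4]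
    simp only [Matrix.mul_assoc]
  have c5 : K * (z • 1 - J'ᴴ * H * J')⁻¹ = (z • 1 - J'ᴴ * H * J')⁻¹ * K := by
    have u1 := Matrix.mul_nonsing_inv _ (good' hz)
    have u2 := Matrix.nonsing_inv_mul _ (good' hz)
    have hc : Commute K (z • 1 - J'ᴴ * H * J') :=
      ((Commute.one_right K).smul_right z).sub_right c4
    let U : (Matrix s' s' ℂ)ˣ := ⟨z • 1 - J'ᴴ * H * J', _, u1, u2⟩
    have : Commute K (U : Matrix s' s' ℂ) := hc
    exact this.units_inv_right
  rw [Matrix.mul_add, Matrix.add_mul, c1, ← Matrix.mul_assoc T, ← Matrix.mul_assoc T, c2,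
    Matrix.mul_assoc _ K, c5, Matrix.mul_assoc _ (J'ᴴ * H * J) T, ← c3]
  simp only [Matrix.mul_assoc]

lemma sub_eq {n s t : Type*} [Fintype n] [DecidableEq n] (M : Matrix n n ℂ) (f : s → n)
    (g : t → n) : M.submatrix f g =
      ((1 : Matrix n n ℂ).submatrix id f)ᴴ * M * (1 : Matrix n n ℂ).submatrix id g := by
  ext i j
  simp [Matrix.mul_apply, Matrix.one_apply, Matrix.submatrix_apply, Finset.sum_ite_eq]

end IsoRed

open IsoRed

/-- Main theorem: for a Hermitian `H` and a normal invertible `T`, the following are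
equivalent: (i) `T` commutes with the isospectral reduction `R_S(H,λ)` for every `λ` outside
the spectrum of `H_{S̄S̄}`; (ii) `T` commutes with `(H^k)_{SS}` for every `k`; (iii) there is a
normal matrix `Q` with `Q_{SS} = T`, vanishing off-diagonal blocks, commuting with `H`. -/
theorem isospectral_reduction_symmetry_tfae {N : ℕ} (S : Finset (Fin N))
    (H : Matrix (Fin N) (Fin N) ℂ) (hH : H.IsHermitian)
    (T : Matrix ↥S ↥S ℂ) (hTnormal : T * Tᴴ = Tᴴ * T) (hTinv : IsUnit T) :
    List.TFAE
      [ (∀ z : ℂ, z ∉ spectrum ℂ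
            (H.submatrix (fun i : ↥Sᶜ => (i : Fin N)) (fun i : ↥Sᶜ => (i : Fin N))) →
          T * (H.submatrix (fun i : ↥S => (i : Fin N)) (fun i : ↥S => (i : Fin N)) +
            H.submatrix (fun i : ↥S => (i : Fin N)) (fun i : ↥Sᶜ => (i : Fin N)) *
              (z • (1 : Matrix ↥Sᶜ ↥Sᶜ ℂ) -
                H.submatrix (fun i : ↥Sᶜ => (i : Fin N)) (fun i : ↥Sᶜ => (i : Fin N)))⁻¹ *
              H.submatrix (fun i : ↥Sᶜ => (i : Fin N)) (fun i : ↥S => (i : Fin N))) =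
          (H.submatrix (fun i : ↥S => (i : Fin N)) (fun i : ↥S => (i : Fin N)) +
            H.submatrix (fun i : ↥S => (i : Fin N)) (fun i : ↥Sᶜ => (i : Fin N)) *
              (z • (1 : Matrix ↥Sᶜ ↥Sᶜ ℂ) -
                H.submatrix (fun i : ↥Sᶜ => (i : Fin N)) (fun i : ↥Sᶜ => (i : Fin N)))⁻¹ *
              H.submatrix (fun i : ↥Sᶜ => (i : Fin N)) (fun i : ↥S => (i : Fin N))) * T),
        (∀ k : ℕ,
          T * (H ^ k).submatrix (fun i : ↥S => (i : Fin N)) (fun i : ↥S => (i : Fin N)) =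
          (H ^ k).submatrix (fun i : ↥S => (i : Fin N)) (fun i : ↥S => (i : Fin N)) * T),
        (∃ Q : Matrix (Fin N) (Fin N) ℂ,
          Q * Qᴴ = Qᴴ * Q ∧
          Q.submatrix (fun i : ↥S => (i : Fin N)) (fun i : ↥S => (i : Fin N)) = T ∧
          Q.submatrix (fun i : ↥S => (i : Fin N)) (fun i : ↥Sᶜ => (i : Fin N)) = 0 ∧
          Q.submatrix (fun i : ↥Sᶜ => (i : Fin N)) (fun i : ↥S => (i : Fin N)) = 0 ∧
          Q * H = H * Q) ] := by
  have id1 : ∀ f : ↥S → Fin N, f = (fun i : ↥S => (i : Fin N)) →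
      ((1 : Matrix (Fin N) (Fin N) ℂ).submatrix id f)ᴴ *
        (1 : Matrix (Fin N) (Fin N) ℂ).submatrix id f = 1 := by
    rintro f rfl
    ext i j
    simp [Matrix.mul_apply, Matrix.one_apply, Subtype.val_inj]
  have hp : ∀ k : ℕ, (H ^ k).submatrix (fun i : ↥S => (i : Fin N)) (fun i : ↥S => (i : Fin N)) =
      ((1 : Matrix (Fin N) (Fin N) ℂ).submatrix id (fun i : ↥S => (i : Fin N)))ᴴ * H ^ k *
        (1 : Matrix (Fin N) (Fin N) ℂ).submatrix id (fun i : ↥S => (i : Fin N)) :=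
    fun k => sub_eq _ _ _
  simp only [sub_eq H, hp]
  have hJ := id1 _ rfl
  have hJ'J : ((1 : Matrix (Fin N) (Fin N) ℂ).submatrix id (fun i : ↥Sᶜ => (i : Fin N)))ᴴ *
        (1 : Matrix (Fin N) (Fin N) ℂ).submatrix id (fun i : ↥S => (i : Fin N)) = 0 := by
    ext i j
    have h1 := Finset.mem_compl.1 i.2
    have h2 : (i : Fin N) ≠ j := fun e => h1 (e ▸ j.2)
    simp [Matrix.mul_apply, Matrix.one_apply, h2]
  have hJJ' : ((1 : Matrix (Fin N) (Fin N) ℂ).submatrix id (fun i : ↥S => (i : Fin N)))ᴴ *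
        (1 : Matrix (Fin N) (Fin N) ℂ).submatrix id (fun i : ↥Sᶜ => (i : Fin N)) = 0 := by
    have := congrArg conjTranspose hJ'J
    simpa only [conjTranspose_mul, conjTranspose_conjTranspose, conjTranspose_zero] using this
  have hJJ : (1 : Matrix (Fin N) (Fin N) ℂ).submatrix id (fun i : ↥S => (i : Fin N)) *
        ((1 : Matrix (Fin N) (Fin N) ℂ).submatrix id (fun i : ↥S => (i : Fin N)))ᴴ +
      (1 : Matrix (Fin N) (Fin N) ℂ).submatrix id (fun i : ↥Sᶜ => (i : Fin N)) *
        ((1 : Matrix (Fin N) (Fin N) ℂ).submatrix id (fun i : ↥Sᶜ => (i : Fin N)))ᴴ = 1 := by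
    ext i j
    rw [Matrix.add_apply, Matrix.mul_apply, Matrix.mul_apply]
    change (∑ x : ↥S, (1 : Matrix (Fin N) (Fin N) ℂ) i x *
        star ((1 : Matrix (Fin N) (Fin N) ℂ) j x)) + (∑ x : ↥Sᶜ,
        (1 : Matrix (Fin N) (Fin N) ℂ) i x * star ((1 : Matrix (Fin N) (Fin N) ℂ) j x)) = _
    rw [Finset.sum_coe_sort S (fun x => (1 : Matrix (Fin N) (Fin N) ℂ) i x *
        star ((1 : Matrix (Fin N) (Fin N) ℂ) j x)),
      Finset.sum_coe_sort Sᶜ (fun x => (1 : Matrix (Fin N) (Fin N) ℂ) i x *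
        star ((1 : Matrix (Fin N) (Fin N) ℂ) j x)), Finset.sum_add_sum_compl]
    simp [Matrix.one_apply, eq_comm]
  tfae_have 1 → 2 := fun h k => one_two H _ _ T hJ hJ'J hJJ h k
  tfae_have 2 → 3 := by
    intro h
    obtain ⟨Q, q1, q2, q3, q4⟩ := two_three H hH _ T hTnormal h
    refine ⟨Q, q1, ?_, ?_, ?_, q4⟩
    · rw [sub_eq, Matrix.mul_assoc, q2, ← Matrix.mul_assoc, hJ, Matrix.one_mul]
    · have := congrArg conjTranspose q3
      simp only [conjTranspose_mul, conjTranspose_conjTranspose] at this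
      rw [sub_eq, this, Matrix.mul_assoc, hJJ', Matrix.mul_zero]
    · rw [sub_eq, Matrix.mul_assoc, q2, ← Matrix.mul_assoc, hJ'J, Matrix.zero_mul]
  tfae_have 3 → 1 := by
    rintro ⟨Q, -, q1, q2, q3, q4⟩ z hz
    rw [sub_eq] at q1 q2 q3
    exact three_one H Q _ _ T hJJ q1 q2 q3 q4 z hz
  tfae_finish
end

section
/- Let H be an N×N Hermitian complex matrix, S a subset of its index set with complement S̄, and T a normal, invertible |S|×|S| complex matrix that commutes with ((H^k))_{SS} for every natural number k. Let φ and ψ be eigenvectors of T with distinct eigenvalues, and let Φ and Ψ be the N-dimensional vectors obtained from φ and ψ by padding with zeros, so that Φ_S = φ, Φ_{S̄} = 0, Ψ_S = ψ and Ψ_{S̄} = 0. Then for all natural numbers k₁ and k₂, the Hermitian inner product ⟨H^{k₁} Φ, H^{k₂} Ψ⟩ equals 0; in particular the Krylov subspaces span(Φ, HΦ, …, H^{N−1}Φ) and span(Ψ, HΨ, …, H^{N−1}Ψ) are orthogonal. -/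
open Matrix

open scoped ComplexOrder in
lemma normal_left_eig {n : Type*} [Fintype n] [DecidableEq n] (T : Matrix n n ℂ)
    (hT : T * Tᴴ = Tᴴ * T) (φ : n → ℂ) (t : ℂ) (h : T *ᵥ φ = t • φ) :
    star φ ᵥ* T = t • star φ := by
  have hM : (T - t • 1) *ᵥ φ = 0 := by
    rw [sub_mulVec, smul_mulVec, one_mulVec, h, sub_self]
  have hc : (T - t • 1) * (T - t • 1)ᴴ = (T - t • 1)ᴴ * (T - t • 1) := by
    simp only [conjTranspose_sub, conjTranspose_smul, conjTranspose_one, sub_mul, mul_sub, hT,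
      smul_mul_assoc, mul_smul_comm, one_mul, mul_one, smul_sub, smul_smul, mul_comm t (star t)]
    abel
  have h0 : (T - t • 1)ᴴ *ᵥ φ = 0 := by
    rw [← dotProduct_star_self_eq_zero, star_mulVec, conjTranspose_conjTranspose,
      ← dotProduct_mulVec, mulVec_mulVec, hc, ← mulVec_mulVec, hM, mulVec_zero, dotProduct_zero]
  have h1 := congrArg star h0
  rw [star_mulVec, conjTranspose_conjTranspose, vecMul_sub, vecMul_smul, vecMul_one, star_zero]
    at h1
  exact sub_eq_zero.mp h1

lemma sum_padded {N : ℕ} (S : Finset (Fin N)) (f : Fin N → ℂ) (hf : ∀ i, i ∉ S → f i = 0) :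
    ∑ i, f i = ∑ i : S, f i := by
  rw [Finset.sum_coe_sort S f]
  exact (Finset.sum_subset (Finset.subset_univ S) (fun i _ hi => hf i hi)).symm

/-- If the normal invertible matrix `T` commutes with every block `(H^k)_{SS}` of the
Hermitian matrix `H`, and `Φ, Ψ` are the zero-paddings of eigenvectors `φ, ψ` of `T` to
distinct eigenvalues, then `⟨H^{k₁} Φ, H^{k₂} Ψ⟩ = 0` for all `k₁, k₂`; in particular the
Krylov subspaces generated by `Φ` and `Ψ` are orthogonal. -/
theorem krylov_subspaces_orthogonal {N : ℕ} (S : Finset (Fin N))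
    (H : Matrix (Fin N) (Fin N) ℂ) (hH : H.IsHermitian)
    (T : Matrix ↥S ↥S ℂ) (hTnormal : T * Tᴴ = Tᴴ * T) (hTinv : IsUnit T)
    (hcomm : ∀ k : ℕ,
      T * (H ^ k).submatrix (fun i : ↥S => (i : Fin N)) (fun i : ↥S => (i : Fin N)) =
      (H ^ k).submatrix (fun i : ↥S => (i : Fin N)) (fun i : ↥S => (i : Fin N)) * T)
    (φ ψ : ↥S → ℂ) (tl tm : ℂ) (hφ : φ ≠ 0) (hψ : ψ ≠ 0)
    (hφeig : T.mulVec φ = tl • φ) (hψeig : T.mulVec ψ = tm • ψ) (hdist : tl ≠ tm)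
    (Φ Ψ : Fin N → ℂ)
    (hΦS : ∀ i : ↥S, Φ i = φ i) (hΦSc : ∀ i : Fin N, i ∉ S → Φ i = 0)
    (hΨS : ∀ i : ↥S, Ψ i = ψ i) (hΨSc : ∀ i : Fin N, i ∉ S → Ψ i = 0) :
    (∀ k₁ k₂ : ℕ, star ((H ^ k₁).mulVec Φ) ⬝ᵥ (H ^ k₂).mulVec Ψ = 0) ∧
    (∀ u ∈ Submodule.span ℂ (Set.range fun j : Fin N => (H ^ (j : ℕ)).mulVec Φ),
     ∀ v ∈ Submodule.span ℂ (Set.range fun j : Fin N => (H ^ (j : ℕ)).mulVec Ψ),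
       star u ⬝ᵥ v = 0) := by
  have key : ∀ k₁ k₂ : ℕ, star ((H ^ k₁).mulVec Φ) ⬝ᵥ (H ^ k₂).mulVec Ψ = 0 := by
    intro k₁ k₂
    have e1 : star ((H ^ k₁).mulVec Φ) ⬝ᵥ (H ^ k₂).mulVec Ψ
        = star Φ ⬝ᵥ (H ^ (k₁ + k₂)) *ᵥ Ψ := by
      rw [star_mulVec, (hH.pow k₁).eq, ← dotProduct_mulVec, mulVec_mulVec, pow_add]
    have e2 : star Φ ⬝ᵥ (H ^ (k₁ + k₂)) *ᵥ Ψ = star φ ⬝ᵥ ((H ^ (k₁ + k₂)).submatrix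
        (fun i : ↥S => (i : Fin N)) (fun i : ↥S => (i : Fin N))) *ᵥ ψ := by
      simp only [dotProduct, mulVec]
      rw [sum_padded S _ (fun i hi => by simp [hΦSc i hi])]
      refine Finset.sum_congr rfl fun i _ => ?_
      rw [sum_padded S _ (fun i hi => by simp [hΨSc i hi])]
      simp [hΦS, hΨS]
    rw [e1, e2]
    have hc := hcomm (k₁ + k₂)
    generalize (H ^ (k₁ + k₂)).submatrix
        (fun i : ↥S => (i : Fin N)) (fun i : ↥S => (i : Fin N)) = B at hc
    have hl := normal_left_eig T hTnormal φ tl hφeig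
    have h3 : tl * (star φ ⬝ᵥ B *ᵥ ψ) = tm * (star φ ⬝ᵥ B *ᵥ ψ) := by
      rw [← smul_eq_mul, ← smul_dotProduct, ← hl, ← dotProduct_mulVec, mulVec_mulVec, hc,
        ← mulVec_mulVec, hψeig, mulVec_smul, dotProduct_smul, smul_eq_mul]
    by_contra hne
    exact hdist (mul_right_cancel₀ hne h3)
  refine ⟨key, fun u hu v hv => ?_⟩
  induction hu using Submodule.span_induction with
  | zero => simp
  | add x y _ _ hx hy => rw [star_add, add_dotProduct, hx, hy, add_zero]
  | smul a x _ hx => rw [star_smul, smul_dotProduct, hx, smul_zero]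
  | mem x hx =>
    obtain ⟨i, rfl⟩ := hx
    induction hv using Submodule.span_induction with
    | zero => simp
    | add x y _ _ hx hy => rw [dotProduct_add, hx, hy, add_zero]
    | smul a x _ hx => rw [dotProduct_smul, hx, smul_zero]
    | mem x hx =>
      obtain ⟨j, rfl⟩ := hx
      exact key i j
end
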